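/- (Theorem 1.) For every γ ∈ (0,1], the maximum of the normalized guessing probability G = V/γ², over all γ-admissible triples (Π₀,Π₁,Π_∅), equals (1/2)·(1 + 1/(2√2·γ²)) if γ > 1/√2, and equals 1/2 + 1/(2√2) if γ ≤ 1/√2; i.e., this value is an upper bound for all γ-admissible triples and is attained by some γ-admissible triple. -/

import Mathlib

open Matrix Complex Kronecker BigOperators ComplexOrder

noncomputable section

abbrev Mat2 := Matrix (Fin 2) (Fin 2) ℂ
abbrev Mat4 := Matrix (Fin 2 × Fin 2) (Fin 2 × Fin 2) ℂ

/-- Pauli X matrix -/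
def PX : Mat2 := !![0, 1; 1, 0]

/-- Pauli Y matrix -/
def PY : Mat2 := !![0, -Complex.I; Complex.I, 0]

/-- sign (−1)^b for a bit b -/
def bsign (b : Bool) : ℂ := if b then -1 else 1

/-- boolean function f(x̄,ȳ) = (x₁·y₁) XOR x₂ XOR y₂ -/
def fxy (x y : Bool × Bool) : Bool := (((x.1 && y.1)).xor x.2).xor y.2

/-- qubit input states ω_{x̄}: ω_{(0,x₂)} = (I+(−1)^{x₂}X)/2, ω_{(1,x₂)} = (I+(−1)^{x₂}Y)/2 -/
def omg (x : Bool × Bool) : Mat2 :=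
  (1/2 : ℂ) • ((1 : Mat2) + bsign x.2 • (if x.1 then PY else PX))

/-- qubit input states τ_{ȳ} = (I+(−1)^{y₂}(X+(−1)^{y₁}Y)/√2)/2 -/
def tau (y : Bool × Bool) : Mat2 :=
  (1/2 : ℂ) • ((1 : Mat2) + (bsign y.2 / (Real.sqrt 2 : ℂ)) • (PX + bsign y.1 • PY))

/-- averaged input states ρ₀ (for c = false) and ρ₁ (for c = true) -/
def rho (c : Bool) : Mat4 :=
  (1/8 : ℂ) • ∑ x : Bool × Bool, ∑ y : Bool × Bool,
    (if fxy x y = c then omg x ⊗ₖ tau y else 0)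

/-- standard basis vectors of ℂ⁴ ≅ ℂ² ⊗ ℂ² -/
def ket (i j : Fin 2) : (Fin 2 × Fin 2) → ℂ := fun p => if p = (i, j) then 1 else 0

def PhiP : (Fin 2 × Fin 2) → ℂ := fun p => (1 / (Real.sqrt 2 : ℂ)) * (ket 0 0 p + ket 1 1 p)
def PhiM : (Fin 2 × Fin 2) → ℂ := fun p => (1 / (Real.sqrt 2 : ℂ)) * (ket 0 0 p - ket 1 1 p)
def PsiP : (Fin 2 × Fin 2) → ℂ := fun p => (1 / (Real.sqrt 2 : ℂ)) * (ket 0 1 p + ket 1 0 p)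
def PsiM : (Fin 2 × Fin 2) → ℂ := fun p => (1 / (Real.sqrt 2 : ℂ)) * (ket 0 1 p - ket 1 0 p)

/-- rank one projector |v⟩⟨v| -/
def proj (v : (Fin 2 × Fin 2) → ℂ) : Mat4 := Matrix.vecMulVec v (star v)

/-- a γ-admissible measurement triple -/
def Admissible (γ : ℝ) (P0 P1 Pe : Mat4) : Prop :=
  P0.PosSemidef ∧ P1.PosSemidef ∧ Pe.PosSemidef ∧
  P0 + P1 + Pe = 1 ∧
  ∀ x y : Bool × Bool, ((omg x ⊗ₖ tau y) * Pe).trace = 1 - (γ : ℂ)^2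

/-- guessing value V = (1/2)·Tr[ρ₀Π₀ + ρ₁Π₁] (a real number) -/
def Gval (P0 P1 : Mat4) : ℝ := (1/2) * ((rho false * P0 + rho true * P1).trace).re

/-- The coherence `|01⟩⟨10| + |10⟩⟨01| = (X ⊗ X + Y ⊗ Y) / 2`. -/
def flipFlop : Mat4 := Matrix.single (0, 1) (1, 0) 1 + Matrix.single (1, 0) (0, 1) 1

lemma ofReal_sqrt_two_inv : ((Real.sqrt 2 : ℝ) : ℂ)⁻¹ = (Real.sqrt 2 : ℂ) / 2 := by
  have h : ((Real.sqrt 2 : ℝ) : ℂ) * (Real.sqrt 2 : ℂ) = 2 := by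
    rw [← Complex.ofReal_mul, Real.mul_self_sqrt zero_le_two, Complex.ofReal_ofNat]
  have h0 : ((Real.sqrt 2 : ℝ) : ℂ) ≠ 0 := by
    intro h0
    simp [h0] at h
  field_simp
  linear_combination -h

set_option maxHeartbeats 1000000 in
lemma rho_eq (c : Bool) :
    rho c = (1 / 4 : ℂ) • (1 : Mat4) + (bsign c * ((Real.sqrt 2 : ℂ) / 8)) • flipFlop := by
  cases c <;> ext ⟨i, j⟩ ⟨k, l⟩ <;> fin_cases i <;> fin_cases j <;> fin_cases k <;> fin_cases l <;>
    simp [rho, fxy, omg, tau, PX, PY, bsign, flipFlop, Fintype.sum_prod_type,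
      Matrix.add_apply, div_eq_mul_inv, ofReal_sqrt_two_inv] <;>
    ring_nf <;> simp <;> ring

lemma sum_omg_kronecker_tau :
    ∑ s : Bool, ∑ t : Bool, omg (false, s) ⊗ₖ tau (false, t) = 1 := by
  ext ⟨i, j⟩ ⟨k, l⟩
  fin_cases i <;> fin_cases j <;> fin_cases k <;> fin_cases l <;>
    simp [omg, tau, PX, PY, bsign, Matrix.add_apply] <;> ring

lemma Gval_eq (P0 P1 : Mat4) :
    Gval P0 P1 = (1 / 8) * (P0 + P1).trace.re + Real.sqrt 2 / 16 *
      ((P0 (0, 1) (1, 0)).re + (P0 (1, 0) (0, 1)).re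
        - (P1 (0, 1) (1, 0)).re - (P1 (1, 0) (0, 1)).re) := by
  simp [Gval, rho_eq, bsign, flipFlop, add_mul, Matrix.trace_single_mul]
  ring

lemma Admissible.trace_eq {γ : ℝ} {P0 P1 Pe : Mat4} (h : Admissible γ P0 P1 Pe) :
    (P0 + P1).trace.re = 4 * γ ^ 2 := by
  obtain ⟨-, -, -, hsum, htr⟩ := h
  have hPe : Pe.trace = 4 * (1 - (γ : ℂ) ^ 2) := by
    rw [← one_mul Pe, ← sum_omg_kronecker_tau]
    simp only [Fintype.sum_bool, add_mul, Matrix.trace_add, htr]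
    ring
  have h1 : (P0 + P1).trace = 4 * ((γ ^ 2 : ℝ) : ℂ) := by
    have h4 := congrArg Matrix.trace hsum
    rw [Matrix.trace_add, hPe, Matrix.trace_one] at h4
    simp at h4 ⊢
    linear_combination h4
  rw [h1]
  simp [-Complex.ofReal_pow]

lemma Matrix.PosSemidef.abs_re_add_re_le {n : Type*} [Fintype n] [DecidableEq n]
    {P : Matrix n n ℂ} (hP : P.PosSemidef) (i j : n) :
    |(P i j).re + (P j i).re| ≤ (P i i).re + (P j j).re := by
  have h (c : ℂ) := (Complex.le_def.1
    (hP.dotProduct_mulVec_nonneg (Pi.single i 1 + c • Pi.single j 1))).1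
  have h1 := h 1
  have h2 := h (-1)
  simp [Matrix.mulVec_add, Matrix.mulVec_neg, dotProduct_add, add_dotProduct, star_add] at h1 h2
  rw [abs_le]
  constructor <;> linarith

lemma Admissible.Gval_le {γ : ℝ} {P0 P1 Pe : Mat4} (h : Admissible γ P0 P1 Pe) :
    Gval P0 P1 ≤ γ ^ 2 / 2 + Real.sqrt 2 / 16 * min 2 (4 * γ ^ 2) := by
  rw [Gval_eq, h.trace_eq]
  have htr := h.trace_eq
  obtain ⟨h0, h1, he, hsum, -⟩ := h
  have hd (i : Fin 2 × Fin 2) : (P0 i i).re + (P1 i i).re + (Pe i i).re = 1 := by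
    simpa using congrArg (fun M : Mat4 => (M i i).re) hsum
  have p0 (i) := (Complex.le_def.1 (h0.diag_nonneg (i := i))).1
  have p1 (i) := (Complex.le_def.1 (h1.diag_nonneg (i := i))).1
  have pe (i) := (Complex.le_def.1 (he.diag_nonneg (i := i))).1
  have b0 := abs_le.1 (h0.abs_re_add_re_le (0, 1) (1, 0))
  have b1 := abs_le.1 (h1.abs_re_add_re_le (0, 1) (1, 0))
  simp only [Complex.zero_re] at p0 p1 pe
  simp only [Matrix.trace, Matrix.diag_apply, Fintype.sum_prod_type, Fin.sum_univ_two,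
    Matrix.add_apply, Complex.add_re] at htr
  have key : (P0 (0, 1) (1, 0)).re + (P0 (1, 0) (0, 1)).re
      - (P1 (0, 1) (1, 0)).re - (P1 (1, 0) (0, 1)).re ≤ min 2 (4 * γ ^ 2) := by
    refine le_min ?_ ?_
    · linarith [hd (0, 1), hd (1, 0), pe (0, 1), pe (1, 0)]
    · linarith [p0 (0, 0), p0 (1, 1), p1 (0, 0), p1 (1, 1)]
  have := mul_le_mul_of_nonneg_left key (by positivity : 0 ≤ Real.sqrt 2 / 16)
  linarith

lemma proj_posSemidef (v : (Fin 2 × Fin 2) → ℂ) : (proj v).PosSemidef :=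
  Matrix.posSemidef_vecMulVec_self_star v

lemma exists_admissible {γ a b : ℝ} (ha : 0 ≤ a) (ha' : a ≤ 1) (hb : 0 ≤ b) (hb' : b ≤ 1)
    (hab : a + b = 2 * γ ^ 2) :
    ∃ P0 P1 Pe : Mat4, Admissible γ P0 P1 Pe ∧
      Gval P0 P1 = γ ^ 2 / 2 + Real.sqrt 2 / 8 * a := by
  have nn {r : ℝ} (hr : 0 ≤ r) : (0 : ℂ) ≤ (r : ℂ) := by exact_mod_cast hr
  let even : Mat4 := proj (ket 0 0) + proj (ket 1 1)
  let odd : Mat4 := proj (ket 0 1) + proj (ket 1 0)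
  have heven : even.PosSemidef := (proj_posSemidef _).add (proj_posSemidef _)
  have hodd : odd.PosSemidef := (proj_posSemidef _).add (proj_posSemidef _)
  have hab' : (a : ℂ) + b = 2 * (γ : ℂ) ^ 2 := by exact_mod_cast hab
  have hadm : Admissible γ
      (((a / 2 : ℝ) : ℂ) • proj (ket 0 1 + ket 1 0) + (b : ℂ) • even)
      (((a / 2 : ℝ) : ℂ) • proj (ket 0 1 - ket 1 0))
      (((1 - b : ℝ) : ℂ) • even + ((1 - a : ℝ) : ℂ) • odd) := by
    refine ⟨((proj_posSemidef _).smul (nn (by positivity))).add (heven.smul (nn hb)),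
      (proj_posSemidef _).smul (nn (by positivity)),
      (heven.smul (nn (by linarith))).add (hodd.smul (nn (by linarith))), ?_, ?_⟩
    · ext ⟨i, j⟩ ⟨k, l⟩
      fin_cases i <;> fin_cases j <;> fin_cases k <;> fin_cases l <;>
        simp [even, odd, proj, ket, Matrix.vecMulVec_apply]
    · rintro ⟨x1, x2⟩ ⟨y1, y2⟩
      have hre : (1 : ℂ) - (γ : ℂ) ^ 2 = ((1 - b) + (1 - a)) / 2 := by
        linear_combination hab' / 2
      rw [hre]
      cases x1 <;> cases x2 <;> cases y1 <;> cases y2 <;>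
        simp [omg, tau, PX, PY, bsign, even, odd, proj, ket, Matrix.vecMulVec_apply, Matrix.trace,
          Matrix.mul_apply, Fintype.sum_prod_type] <;> ring
  refine ⟨_, _, _, hadm, ?_⟩
  rw [Gval_eq, hadm.trace_eq]
  simp [even, proj, ket, Matrix.vecMulVec_apply]
  ring

/-- Theorem 1: for every γ ∈ (0,1], the maximum of G = V/γ² over all
γ-admissible triples equals (1/2)(1 + 1/(2√2γ²)) if γ > 1/√2 and 1/2 + 1/(2√2) otherwise. -/
theorem optimal_guessing_probability (γ : ℝ) (hγ : 0 < γ) (hγ' : γ ≤ 1) :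
    IsGreatest {g : ℝ | ∃ P0 P1 Pe : Mat4, Admissible γ P0 P1 Pe ∧ g = Gval P0 P1 / γ^2}
      (if 1/Real.sqrt 2 < γ then (1/2) * (1 + 1/(γ^2 * (2*Real.sqrt 2)))
       else 1/2 + 1/(2*Real.sqrt 2)) := by
  have hγ2 : 0 < γ ^ 2 := by positivity
  have hγ1 : γ ^ 2 ≤ 1 := pow_le_one₀ hγ.le hγ'
  have hs : 0 < Real.sqrt 2 := by positivity
  have hs2 : Real.sqrt 2 ^ 2 = 2 := Real.sq_sqrt zero_le_two
  have hcond : 1 / Real.sqrt 2 < γ ↔ 1 / 2 < γ ^ 2 := by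
    rw [← pow_lt_pow_iff_left₀ (by positivity) hγ.le two_ne_zero, div_pow, hs2, one_pow]
  have hval : (if 1/Real.sqrt 2 < γ then (1/2) * (1 + 1/(γ^2 * (2*Real.sqrt 2)))
      else 1/2 + 1/(2*Real.sqrt 2)) =
      (γ ^ 2 / 2 + Real.sqrt 2 / 8 * min 1 (2 * γ ^ 2)) / γ ^ 2 := by
    split_ifs with h
    · rw [min_eq_left (by linarith [hcond.1 h])]
      field_simp
      linear_combination -4 * hs2
    · rw [min_eq_right (by linarith [not_lt.1 (mt hcond.2 h)])]
      field_simp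
      linear_combination -4 * hs2
  rw [hval]
  constructor
  · have hm := min_add_max 1 (2 * γ ^ 2)
    obtain ⟨P0, P1, Pe, hadm, hG⟩ := exists_admissible (γ := γ) (a := min 1 (2 * γ ^ 2))
      (b := max 1 (2 * γ ^ 2) - 1) (by positivity) (min_le_left _ _)
      (by linarith [le_max_left 1 (2 * γ ^ 2)])
      (by linarith [max_le (by norm_num : (1 : ℝ) ≤ 2) (by linarith : 2 * γ ^ 2 ≤ 2)])
      (by linarith)
    exact ⟨P0, P1, Pe, hadm, by rw [hG]⟩
  · rintro _ ⟨P0, P1, Pe, hadm, rfl⟩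
    have h2 : min 2 (4 * γ ^ 2) = 2 * min 1 (2 * γ ^ 2) := by
      rw [mul_min_of_nonneg _ _ zero_le_two]
      ring_nf
    have hle := hadm.Gval_le
    rw [h2] at hle
    gcongr
    linarith
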